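/- arXiv:math/0212242 — 2 statements merged into one kernel-verified Lean document; each statement's English description precedes it below -/
import Mathlib

section
/- Let E be a strongly connected directed graph with period d and let c : E¹ → ℤ be the labelling c(e) = 1 for all edges e. Then for every vertex v the local voltage group Γ_v(c) equals the subgroup dℤ of ℤ. -/
/-- A directed graph with vertex type `V` and edge type `E`. -/
structure DiGraph (V : Type) (E : Type) where
  s : E → V
  r : E → V

namespace DiGraph

variable {V E : Type} (G : DiGraph V E)

/-- A dart is an edge traversed forwards (`inl`) or backwards (`inr`). -/
def dartS : E ⊕ E → V := fun d => match d with | .inl e => G.s e | .inr e => G.r e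

def dartR : E ⊕ E → V := fun d => match d with | .inl e => G.r e | .inr e => G.s e

/-- `l` is a walk (as a list of darts). -/
def IsWalk (l : List (E ⊕ E)) : Prop := l.Chain' (fun d d' => G.dartR d = G.dartS d')

/-- `l` is a walk from `v` to `w`. -/
def IsWalkFrom (v w : V) (l : List (E ⊕ E)) : Prop :=
  G.IsWalk l ∧ (∀ d ∈ l.head?, G.dartS d = v) ∧ (∀ d ∈ l.getLast?, G.dartR d = w) ∧
    (l = [] → v = w)

/-- `l` is a (directed) path, as a list of edges. -/
def IsPath (l : List E) : Prop := l.Chain' (fun e e' => G.r e = G.s e')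

/-- `l` is a path from `v` to `w` (vertices count as paths of length `0`). -/
def IsPathFrom (v w : V) (l : List E) : Prop :=
  G.IsPath l ∧ (∀ e ∈ l.head?, G.s e = v) ∧ (∀ e ∈ l.getLast?, G.r e = w) ∧
    (l = [] → v = w)

/-- An infinite path. -/
def IsInfPath (x : ℕ → E) : Prop := ∀ i, G.r (x i) = G.s (x (i + 1))

/-- The graph is cofinal. -/
def Cofinal : Prop :=
  ∀ x : ℕ → E, G.IsInfPath x → ∀ v : V, ∃ n : ℕ, ∃ l : List E, G.IsPathFrom v (G.r (x n)) l

/-- The graph is strongly connected. -/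
def StronglyConnected : Prop :=
  ∀ v w : V, ∃ l : List E, l ≠ [] ∧ G.IsPathFrom v w l

/-- The set of lengths of loops based at `v`. -/
def loopLengths (v : V) : Set ℕ :=
  {n | 0 < n ∧ ∃ l : List E, l.length = n ∧ G.IsPathFrom v v l}

/-- Two vertices are joined by a walk. -/
def Reachable (v w : V) : Prop := ∃ l : List (E ⊕ E), G.IsWalkFrom v w l

/-- The graph is connected. -/
def Connected : Prop := ∀ v w : V, G.Reachable v w

end DiGraph

/-- `d` is the greatest common divisor of the set `S` of natural numbers. -/
def IsGcdOf (d : ℕ) (S : Set ℕ) : Prop :=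
  (∀ n ∈ S, d ∣ n) ∧ ∀ k : ℕ, (∀ n ∈ S, k ∣ n) → k ∣ d

/-- The skew product graph `E ×_c Γ`. -/
def DiGraph.skew {V E : Type} (G : DiGraph V E) (Γ : Type) [Group Γ] (c : E → Γ) :
    DiGraph (V × Γ) (E × Γ) where
  s := fun x => (G.s x.1, x.2)
  r := fun x => (G.r x.1, x.2 * c x.1)

/-- The label of a walk: the product of the labels of its darts. -/
def cWalk {E Γ : Type} [Group Γ] (c : E → Γ) (l : List (E ⊕ E)) : Γ :=
  (l.map (fun d => match d with | .inl e => c e | .inr e => (c e)⁻¹)).prod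

/-- The local voltage group of `c` based at `v`, as a set. -/
def voltage {V E : Type} (G : DiGraph V E) {Γ : Type} [Group Γ] (c : E → Γ) (v : V) : Set Γ :=
  {g | ∃ l : List (E ⊕ E), G.IsWalkFrom v v l ∧ cWalk c l = g}

/-- The label of a walk for the canonical labelling `c(e) = 1` into `ℤ`: the number of
forward edges minus the number of reversed edges. -/
def cWalkZ {E : Type} (l : List (E ⊕ E)) : ℤ :=
  (l.map (fun d => match d with | .inl _ => (1 : ℤ) | .inr _ => (-1 : ℤ))).sum

namespace DiGraph

variable {V E : Type} {G : DiGraph V E}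

theorem isWalkFrom_nil {v w : V} : G.IsWalkFrom v w [] ↔ v = w := by
  simp [IsWalkFrom, IsWalk, List.Chain']

theorem isWalkFrom_cons {v w : V} {a : E ⊕ E} {l : List (E ⊕ E)} :
    G.IsWalkFrom v w (a :: l) ↔ G.dartS a = v ∧ G.IsWalkFrom (G.dartR a) w l := by
  cases l with
  | nil => simp [IsWalkFrom, IsWalk, List.Chain']
  | cons b l =>
    simp only [IsWalkFrom, IsWalk, List.Chain', List.isChain_cons_cons, List.head?_cons,
      List.getLast?_cons_cons, Option.mem_def, Option.some.injEq, forall_eq', reduceCtorEq,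
      false_imp_iff, and_true]
    grind

theorem isPathFrom_iff_isWalkFrom_map_inl {v w : V} {p : List E} :
    G.IsPathFrom v w p ↔ G.IsWalkFrom v w (p.map Sum.inl) := by
  simp [IsPathFrom, IsWalkFrom, IsPath, IsWalk, List.Chain', List.isChain_map, dartS, dartR]

theorem IsWalkFrom.append {u v w : V} {l m : List (E ⊕ E)} (hl : G.IsWalkFrom u v l)
    (hm : G.IsWalkFrom v w m) : G.IsWalkFrom u w (l ++ m) := by
  induction l generalizing u with
  | nil => rwa [isWalkFrom_nil.1 hl]
  | cons a l ih =>
    rw [isWalkFrom_cons] at hl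
    exact isWalkFrom_cons.2 ⟨hl.1, ih hl.2⟩

theorem IsPathFrom.append {u v w : V} {p q : List E} (hp : G.IsPathFrom u v p)
    (hq : G.IsPathFrom v w q) : G.IsPathFrom u w (p ++ q) := by
  rw [isPathFrom_iff_isWalkFrom_map_inl] at *
  simpa using hp.append hq

theorem isPathFrom_singleton (e : E) : G.IsPathFrom (G.s e) (G.r e) [e] := by
  simp [IsPathFrom, IsPath, List.Chain']

theorem isWalkFrom_singleton_swap (a : E ⊕ E) :
    G.IsWalkFrom (G.dartR a) (G.dartS a) [a.swap] := by
  rw [isWalkFrom_cons, isWalkFrom_nil]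
  cases a <;> exact ⟨rfl, rfl⟩

end DiGraph

theorem cWalkZ_nil {E : Type} : cWalkZ ([] : List (E ⊕ E)) = 0 := rfl

theorem cWalkZ_append {E : Type} (l m : List (E ⊕ E)) :
    cWalkZ (l ++ m) = cWalkZ l + cWalkZ m := by
  simp [cWalkZ]

theorem cWalkZ_inl_cons {E : Type} (e : E) (l : List (E ⊕ E)) :
    cWalkZ (Sum.inl e :: l) = 1 + cWalkZ l := by
  simp [cWalkZ]

theorem cWalkZ_inr_cons {E : Type} (e : E) (l : List (E ⊕ E)) :
    cWalkZ (Sum.inr e :: l) = -1 + cWalkZ l := by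
  simp [cWalkZ]

theorem cWalkZ_map_inl {E : Type} (p : List E) : cWalkZ (p.map Sum.inl) = p.length := by
  induction p with
  | nil => rfl
  | cons e p ih =>
    rw [List.map_cons, cWalkZ_inl_cons, ih, List.length_cons]
    push_cast
    ring

namespace DiGraph

variable {V E : Type} {G : DiGraph V E}

theorem IsWalkFrom.exists_reverse {v w : V} {l : List (E ⊕ E)} (hl : G.IsWalkFrom v w l) :
    ∃ m, G.IsWalkFrom w v m ∧ cWalkZ m = -cWalkZ l := by
  induction l generalizing v with
  | nil => exact ⟨[], isWalkFrom_nil.2 (isWalkFrom_nil.1 hl).symm, by simp [cWalkZ_nil]⟩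
  | cons a l ih =>
    obtain ⟨rfl, ht⟩ := isWalkFrom_cons.1 hl
    obtain ⟨m, hm, hc⟩ := ih ht
    refine ⟨m ++ [a.swap], hm.append (isWalkFrom_singleton_swap a), ?_⟩
    rw [cWalkZ_append, hc]
    cases a <;>
      simp only [Sum.swap_inl, Sum.swap_inr, cWalkZ_inl_cons, cWalkZ_inr_cons, cWalkZ_nil] <;>
      ring

/-- The local voltage group at `v` of the constant labelling `1`. -/
def voltageSubgroup (G : DiGraph V E) (v : V) : AddSubgroup ℤ where
  carrier := {n | ∃ l, G.IsWalkFrom v v l ∧ cWalkZ l = n}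
  zero_mem' := ⟨[], isWalkFrom_nil.2 rfl, rfl⟩
  add_mem' := by
    rintro _ _ ⟨l, hl, rfl⟩ ⟨m, hm, rfl⟩
    exact ⟨l ++ m, hl.append hm, cWalkZ_append l m⟩
  neg_mem' := by
    rintro _ ⟨l, hl, rfl⟩
    exact hl.exists_reverse

theorem dvd_length_of_isPathFrom {d : ℕ} {v : V} (hd : ∀ n ∈ G.loopLengths v, d ∣ n)
    {p : List E} (hp : G.IsPathFrom v v p) : d ∣ p.length := by
  rcases p.length.eq_zero_or_pos with h | h
  · simp [h]
  · exact hd _ ⟨h, p, rfl, hp⟩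

/-- Closing a walk up with a directed path gives a total label divisible by every common divisor
of the loop lengths. -/
theorem IsWalkFrom.dvd_cWalkZ_add_length (hsc : G.StronglyConnected) {d : ℕ}
    (hd : ∀ u, ∀ n ∈ G.loopLengths u, d ∣ n) {u w : V} {l : List (E ⊕ E)}
    (hl : G.IsWalkFrom u w l) {p : List E} (hp : G.IsPathFrom w u p) :
    (d : ℤ) ∣ cWalkZ l + p.length := by
  induction l generalizing u p with
  | nil =>
    obtain rfl := isWalkFrom_nil.1 hl
    simpa [cWalkZ_nil] using Int.natCast_dvd_natCast.2 (dvd_length_of_isPathFrom (hd u) hp)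
  | cons a l ih =>
    obtain ⟨rfl, ht⟩ := isWalkFrom_cons.1 hl
    cases a with
    | inl e =>
      have h := ih ht (hp.append (isPathFrom_singleton e))
      rw [List.length_append, List.length_singleton] at h
      rw [cWalkZ_inl_cons]
      convert h using 1
      push_cast
      ring
    | inr e =>
      obtain ⟨q, -, hq⟩ := hsc (G.r e) (G.s e)
      have h := ih ht (hp.append hq)
      have hloop := Int.natCast_dvd_natCast.2
        (dvd_length_of_isPathFrom (hd _) ((isPathFrom_singleton e).append hq))
      rw [List.length_append] at h
      rw [List.length_append, List.length_singleton] at hloop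
      rw [cWalkZ_inr_cons]
      convert Int.dvd_sub h hloop using 1
      push_cast
      ring

theorem mem_voltageSubgroup_of_isGcdOf {d : ℕ} {v : V} (hd : IsGcdOf d (G.loopLengths v)) :
    (d : ℤ) ∈ G.voltageSubgroup v := by
  obtain ⟨a, ha⟩ := Int.subgroup_cyclic (G.voltageSubgroup v)
  rw [← AddSubgroup.zmultiples_eq_closure] at ha
  rw [ha, Int.mem_zmultiples_iff, ← Int.natAbs_dvd, Int.natCast_dvd_natCast]
  refine hd.2 _ ?_
  rintro _ ⟨-, p, rfl, hp⟩
  rw [← Int.natCast_dvd_natCast, Int.natAbs_dvd, ← Int.mem_zmultiples_iff, ← ha]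
  exact ⟨_, isPathFrom_iff_isWalkFrom_map_inl.1 hp, cWalkZ_map_inl p⟩

end DiGraph

/-- For a strongly connected graph of period `d` and the labelling
`c(e) = 1` into `ℤ`, the local voltage group based at any vertex is `dℤ`. -/
theorem voltage_eq_period_multiples
    {V E : Type} (G : DiGraph V E) (hsc : G.StronglyConnected)
    (d : ℕ) (hd : ∀ u : V, IsGcdOf d (G.loopLengths u)) (v : V) :
    {n : ℤ | ∃ l : List (E ⊕ E), G.IsWalkFrom v v l ∧ cWalkZ l = n} =
      {n : ℤ | (d : ℤ) ∣ n} := by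
  ext n
  constructor
  · rintro ⟨l, hl, rfl⟩
    have hp : G.IsPathFrom v v [] :=
      DiGraph.isPathFrom_iff_isWalkFrom_map_inl.2 (DiGraph.isWalkFrom_nil.2 rfl)
    simpa using hl.dvd_cWalkZ_add_length hsc (fun u => (hd u).1) hp
  · rintro ⟨k, rfl⟩
    change _ ∈ G.voltageSubgroup v
    rw [mul_comm, ← smul_eq_mul]
    exact zsmul_mem (DiGraph.mem_voltageSubgroup_of_isGcdOf (hd v)) k
end

section
/- Let E be a row-finite directed graph with infinitely many vertices and no sinks, and suppose E is strongly connected or has no loops. Then for every vertex v there exists a v-depth-first infinite path: an infinite path x = (x_i)_{i≥1} with s(x₁) = v such that for every n ≥ 1 there is no path of length less than n from v to r(x_n). -/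
namespace DiGraph

variable {V E : Type} {G : DiGraph V E} {u v w : V} {e : E} {l l' : List E}

theorem isPath_iff_isChain : G.IsPath l ↔ l.IsChain (fun e e' => G.r e = G.s e') :=
  Iff.rfl

theorem isPathFrom_nil : G.IsPathFrom v w [] ↔ v = w := by
  simp [IsPathFrom, isPath_iff_isChain]

theorem isPathFrom_cons : G.IsPathFrom v w (e :: l) ↔ G.s e = v ∧ G.IsPathFrom (G.r e) w l := by
  cases l with
  | nil => simp [IsPathFrom, isPath_iff_isChain]
  | cons a l =>
    simp only [IsPathFrom, isPath_iff_isChain, List.isChain_cons_cons, List.head?_cons,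
      Option.mem_def, Option.some.injEq, forall_eq', List.getLast?_cons_cons, reduceCtorEq,
      false_implies]
    grind

theorem IsPathFrom.append_s18 (h : G.IsPathFrom u v l) (h' : G.IsPathFrom v w l') :
    G.IsPathFrom u w (l ++ l') := by
  induction l generalizing u with
  | nil => rwa [isPathFrom_nil.1 h]
  | cons e l ih =>
    rw [isPathFrom_cons] at h
    exact isPathFrom_cons.2 ⟨h.1, ih h.2⟩

theorem exists_isPathFrom_iterate {f : V → E} (hf : ∀ v, G.s (f v) = v) (n : ℕ) (v : V) :
    ∃ l : List E, l.length = n ∧ G.IsPathFrom v ((fun u => G.r (f u))^[n] v) l := by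
  induction n generalizing v with
  | zero => exact ⟨[], rfl, isPathFrom_nil.2 rfl⟩
  | succ n ih =>
    obtain ⟨l, hl, h⟩ := ih (G.r (f v))
    exact ⟨f v :: l, by simp [hl], isPathFrom_cons.2 ⟨hf v, h⟩⟩

theorem infinite_setOf_isPathFrom_of_no_loops (hnosink : ∀ v : V, ∃ e : E, G.s e = v)
    (hloop : ¬ ∃ (v : V) (l : List E), l ≠ [] ∧ G.IsPathFrom v v l) (v : V) :
    {w | ∃ l, G.IsPathFrom v w l}.Infinite := by
  choose f hf using hnosink
  have hne : ∀ m n, m < n →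
      (fun u => G.r (f u))^[m] v ≠ (fun u => G.r (f u))^[n] v := by
    intro m n hmn heq
    obtain ⟨l, hl, h⟩ := exists_isPathFrom_iterate hf (n - m) ((fun u => G.r (f u))^[m] v)
    rw [← Function.iterate_add_apply, Nat.sub_add_cancel hmn.le, ← heq] at h
    refine hloop ⟨_, l, ?_, h⟩
    rintro rfl
    simp at hl
    omega
  refine Set.infinite_of_injective_forall_mem (f := fun n => (fun u => G.r (f u))^[n] v) ?_ ?_
  · intro m n heq
    by_contra hmn
    rcases lt_or_gt_of_ne hmn with h | h
    · exact hne _ _ h heq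
    · exact hne _ _ h heq.symm
  · intro n
    obtain ⟨l, -, h⟩ := exists_isPathFrom_iterate hf n v
    exact ⟨l, h⟩

/-- `l` is a path from `v` to `w` of minimal length. -/
def IsGeodesic (G : DiGraph V E) (v w : V) (l : List E) : Prop :=
  G.IsPathFrom v w l ∧ ∀ p, G.IsPathFrom v w p → l.length ≤ p.length

theorem exists_isGeodesic (h : ∃ l, G.IsPathFrom v w l) : ∃ l, G.IsGeodesic v w l := by
  obtain ⟨l, hl, hmin⟩ := exists_minimalFor_of_wellFoundedLT (G.IsPathFrom v w) List.length h
  exact ⟨l, hl, fun p hp => (le_total _ _).elim id (hmin hp)⟩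

/-- The initial segment of a geodesic is a geodesic. -/
theorem IsGeodesic.of_append (h : G.IsGeodesic v w (l ++ l')) (hl : G.IsPathFrom v u l)
    (hl' : G.IsPathFrom u w l') : G.IsGeodesic v u l := by
  refine ⟨hl, fun p hp => ?_⟩
  have := h.2 _ (hp.append_s18 hl')
  simpa using this

/-- The endpoints of the geodesics from `v` which extend the path `l` from `v` to `u`. -/
def geodesicExtensions (G : DiGraph V E) (v u : V) (l : List E) : Set V :=
  {w | ∃ l', G.IsPathFrom u w l' ∧ G.IsGeodesic v w (l ++ l')}

theorem exists_infinite_geodesicExtensions_append (hrow : ∀ v : V, {e : E | G.s e = v}.Finite)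
    (h : (G.geodesicExtensions v u l).Infinite) :
    ∃ e, G.s e = u ∧ (G.geodesicExtensions v (G.r e) (l ++ [e])).Infinite := by
  by_contra! hfin
  refine h (((Set.finite_singleton u).union ((hrow u).biUnion
    fun e he => hfin e he)).subset ?_)
  rintro w ⟨_ | ⟨e, l'⟩, hl', hgeo⟩
  · exact Or.inl (isPathFrom_nil.1 hl').symm
  · rw [isPathFrom_cons] at hl'
    refine Or.inr (Set.mem_biUnion hl'.1 ⟨l', hl'.2, ?_⟩)
    simpa using hgeo

/-- König's lemma for geodesics. -/
theorem exists_infPath_of_infinite_setOf_isPathFrom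
    (hrow : ∀ v : V, {e : E | G.s e = v}.Finite) (h : {w | ∃ l, G.IsPathFrom v w l}.Infinite) :
    ∃ x : ℕ → E, G.IsInfPath x ∧ G.s (x 0) = v ∧
      ∀ i : ℕ, ∀ p : List E, G.IsPathFrom v (G.r (x i)) p → i + 1 ≤ p.length := by
  let S := {a : V × List E // G.IsPathFrom v a.1 a.2 ∧ (G.geodesicExtensions v a.1 a.2).Infinite}
  choose next hs hinf using fun a : S =>
    exists_infinite_geodesicExtensions_append hrow a.2.2
  let succ : S → S := fun a => ⟨(G.r (next a), a.1.2 ++ [next a]),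
    a.2.1.append_s18 (isPathFrom_cons.2 ⟨hs a, isPathFrom_nil.2 rfl⟩), hinf a⟩
  let start : S := ⟨(v, []), isPathFrom_nil.2 rfl, h.mono fun w hw => by
    obtain ⟨l, hl⟩ := exists_isGeodesic hw
    exact ⟨l, hl.1, hl⟩⟩
  have hsucc : ∀ i, succ^[i + 1] start = succ (succ^[i] start) :=
    fun i => Function.iterate_succ_apply' ..
  have hlen : ∀ i, (succ^[i] start).1.2.length = i := by
    intro i
    induction i with
    | zero => rfl
    | succ i ih => simp [hsucc, succ, ih]
  refine ⟨fun i => next (succ^[i] start), fun i => ?_, hs start, fun i p hp => ?_⟩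
  · rw [hs, hsucc]
  · obtain ⟨w, l', hl', hgeo⟩ := (succ^[i + 1] start).2.2.nonempty
    have hmin := (hgeo.of_append (succ^[i + 1] start).2.1 hl').2 p
    rw [hlen, hsucc] at hmin
    exact hmin hp

end DiGraph

/-- In a row-finite graph with infinitely many vertices and no sinks
which is strongly connected or has no loops, every vertex `v` admits a `v`-depth-first
infinite path: an infinite path `x` with source `v` such that for every `n ≥ 1` there
is no path from `v` to `r(x_n)` of length less than `n` (here `x` is indexed from `0`,
so `r(x_n)` for `n ≥ 1` corresponds to `r(x i)` with `i = n - 1 ≥ 0`). -/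
theorem exists_depth_first_path
    {V E : Type} (G : DiGraph V E)
    (hrow : ∀ v : V, {e : E | G.s e = v}.Finite)
    (hinf : Infinite V)
    (hnosink : ∀ v : V, ∃ e : E, G.s e = v)
    (hcase : G.StronglyConnected ∨ ¬ ∃ (v : V) (l : List E), l ≠ [] ∧ G.IsPathFrom v v l)
    (v : V) :
    ∃ x : ℕ → E, G.IsInfPath x ∧ G.s (x 0) = v ∧
      ∀ i : ℕ, ∀ p : List E, G.IsPathFrom v (G.r (x i)) p → i + 1 ≤ p.length := by
  refine DiGraph.exists_infPath_of_infinite_setOf_isPathFrom hrow ?_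
  rcases hcase with hconn | hloop
  · refine Set.infinite_univ.mono fun w _ => ?_
    obtain ⟨l, -, hl⟩ := hconn v w
    exact ⟨l, hl⟩
  · exact DiGraph.infinite_setOf_isPathFrom_of_no_loops hnosink hloop v
end
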